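/- Let X be an a.s. continuous H-self-similar process (H ∈ (0,1)) with M_t = sup_{0≤s≤t} X_s, ℙ(M_1 > 0) = 1 and E[M_1] < ∞, record measure μ (with μ((0,t]) = M_t), and rescaling (s_r f)_t = r^{-H} f(rt). Then for every bounded measurable g : C([0,∞),ℝ) → [0,∞), the set function A ↦ E[∫_A g(s_r X) μ(dr)] on Borel subsets of (0,∞) is a multiple of the hyperbolic measure κ(ds) = H s^{H-1} ds: for every Borel A ⊆ (0,∞), E[∫_A g(s_r X) μ(dr)] = κ(A) · E[∫_{(0,1]} g(s_r X) μ(dr)]. In particular, in the definition of the Palm measure of μ, the choice of the reference set A plays no role. -/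

import Mathlib

open MeasureTheory ProbabilityTheory Set Filter
open scoped NNReal ENNReal

noncomputable section

/-- Rescaling of a path by factor `r` with index `H`: `(s_r f)_t = r^{-H} f(rt)`. -/
def scl (H : ℝ) (r : ℝ≥0) (f : ℝ≥0 → ℝ) : ℝ≥0 → ℝ := fun t => (r : ℝ) ^ (-H) * f (r * t)

/-- Running maximum `M_t = sup_{0 ≤ s ≤ t} f s`. -/
def runMax (f : ℝ≥0 → ℝ) (t : ℝ≥0) : ℝ := sSup (f '' Set.Iic t)

/-- First passage time `T_x = inf {t ≥ 0 : f t ≥ x}` (junk value `0` if the level is never reached). -/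
def fpt (f : ℝ≥0 → ℝ) (x : ℝ) : ℝ≥0 := sInf {t : ℝ≥0 | x ≤ f t}

/-- `H`-self-similarity of a process: for every `c > 0` the rescaled process
`(c^{-H} X_{ct})_{t ≥ 0}` has the same law as `X` on path space. -/
def SelfSimilar {Ω : Type*} [MeasurableSpace Ω] (P : Measure Ω) (H : ℝ)
    (X : Ω → ℝ≥0 → ℝ) : Prop :=
  ∀ c : ℝ≥0, 0 < c → Measure.map (fun ω => scl H c (X ω)) P = Measure.map (fun ω => X ω) P

/-- The hyperbolic measure `κ(ds) = H s^{H-1} ds` on `(0,∞)`, as a measure on `ℝ≥0`. -/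
def hypMeasure (H : ℝ) : Measure ℝ≥0 :=
  Measure.map Real.toNNReal
    (((volume : Measure ℝ).restrict (Set.Ioi 0)).withDensity
      fun s => ENNReal.ofReal (H * s ^ (H - 1)))


/-- Continuous paths, with the trace of the product sigma-algebra. -/
abbrev CPath := {f : ℝ≥0 → ℝ // Continuous f}

lemma le_runMax_iff {f : ℝ≥0 → ℝ} (hf : Continuous f) (x : ℝ) (t : ℝ≥0) :
    x ≤ runMax f t ↔ ∃ s, s ≤ t ∧ x ≤ f s := by
  have hc : IsCompact (Set.Iic t) := by
    have : Set.Iic t = Set.Icc 0 t := by ext; simp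
    rw [this]; exact isCompact_Icc
  have hne : (Set.Iic t).Nonempty := ⟨t, Set.mem_Iic.2 le_rfl⟩
  constructor
  · intro h
    obtain ⟨s, hs, hs'⟩ := hc.exists_sSup_image_eq hne hf.continuousOn
    refine ⟨s, hs, ?_⟩
    rw [← hs']; exact h
  · rintro ⟨s, hs, hx⟩
    exact hx.trans (le_csSup (hc.image hf).bddAbove ⟨s, hs, rfl⟩)

lemma lt_runMax_iff {f : ℝ≥0 → ℝ} (hf : Continuous f) (x : ℝ) (t : ℝ≥0) :
    x < runMax f t ↔ ∃ s, s ≤ t ∧ x < f s := by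
  constructor
  · intro h
    obtain ⟨s, hs, hx⟩ := (le_runMax_iff hf (runMax f t) t).1 le_rfl
    exact ⟨s, hs, h.trans_le hx⟩
  · rintro ⟨s, hs, hx⟩
    exact hx.trans_le ((le_runMax_iff hf _ t).2 ⟨s, hs, le_rfl⟩)

lemma measurable_runMax (t : ℝ≥0) : Measurable (fun f : CPath => runMax f.1 t) := by
  refine measurable_of_Ioi fun a => ?_
  have : (fun f : CPath => runMax f.1 t) ⁻¹' Set.Ioi a
      = ⋃ n : ℕ, {f : CPath | a < f.1 (min t (TopologicalSpace.denseSeq ℝ≥0 n))} := by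
    ext f
    simp only [Set.mem_preimage, Set.mem_Ioi, Set.mem_iUnion, Set.mem_ofPred_eq]
    rw [lt_runMax_iff f.2]
    constructor
    · rintro ⟨s, hs, hx⟩
      have ho : IsOpen {u : ℝ≥0 | a < f.1 (min t u)} :=
        isOpen_lt continuous_const (f.2.comp (continuous_const.min continuous_id))
      obtain ⟨u, hu, n, rfl⟩ := (TopologicalSpace.denseRange_denseSeq ℝ≥0).exists_mem_open ho
        ⟨s, by simpa [min_eq_right hs] using hx⟩ |> fun ⟨n, hn⟩ => (⟨_, hn, n, rfl⟩ :
          ∃ u, u ∈ {u : ℝ≥0 | a < f.1 (min t u)} ∧ ∃ n, TopologicalSpace.denseSeq ℝ≥0 n = u)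
      exact ⟨n, hu⟩
    · rintro ⟨n, hn⟩
      exact ⟨_, min_le_left _ _, hn⟩
  rw [this]
  refine MeasurableSet.iUnion fun n => ?_
  exact measurableSet_lt measurable_const ((measurable_pi_apply _).comp measurable_subtype_coe)

lemma fpt_le_iff {f : ℝ≥0 → ℝ} (hf : Continuous f) {x : ℝ} (hx : ∃ t, x ≤ f t) (t : ℝ≥0) :
    fpt f x ≤ t ↔ ∃ s, s ≤ t ∧ x ≤ f s := by
  have hcl : IsClosed {t : ℝ≥0 | x ≤ f t} := isClosed_le continuous_const hf
  constructor
  · intro h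
    exact ⟨_, h, hcl.csInf_mem hx (OrderBot.bddBelow _)⟩
  · rintro ⟨s, hs, h⟩
    exact (csInf_le (OrderBot.bddBelow {t : ℝ≥0 | x ≤ f t}) (Set.mem_ofPred_eq ▸ h)).trans hs

/-- Levels in `(0,∞)` that are reached. -/
def reached (f : ℝ≥0 → ℝ) : Set ℝ := {x | 0 < x ∧ ∃ t, x ≤ f t}

lemma exists_reach_iff {f : ℝ≥0 → ℝ} (hf : Continuous f) (x : ℝ) :
    (∃ t, x ≤ f t) ↔ ∃ n : ℕ, x ≤ runMax f n := by
  constructor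
  · rintro ⟨t, ht⟩
    obtain ⟨n, hn⟩ := exists_nat_ge t
    exact ⟨n, (le_runMax_iff hf _ _).2 ⟨t, hn, ht⟩⟩
  · rintro ⟨n, hn⟩
    obtain ⟨s, _, h⟩ := (le_runMax_iff hf _ _).1 hn
    exact ⟨s, h⟩

lemma measurableSet_le_runMax (t : ℝ≥0) :
    MeasurableSet {p : CPath × ℝ | p.2 ≤ runMax p.1.1 t} :=
  measurableSet_le measurable_snd ((measurable_runMax t).comp measurable_fst)

lemma measurableSet_reach : MeasurableSet {p : CPath × ℝ | ∃ t, p.2 ≤ p.1.1 t} := by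
  have : {p : CPath × ℝ | ∃ t, p.2 ≤ p.1.1 t}
      = ⋃ n : ℕ, {p : CPath × ℝ | p.2 ≤ runMax p.1.1 n} := by
    ext p
    simp only [Set.mem_ofPred_eq, Set.mem_iUnion]
    exact exists_reach_iff p.1.2 _
  rw [this]
  exact MeasurableSet.iUnion fun n => measurableSet_le_runMax _

lemma measurable_fpt : Measurable (fun p : CPath × ℝ => fpt p.1.1 p.2) := by
  refine measurable_of_Iic fun t => ?_
  have : (fun p : CPath × ℝ => fpt p.1.1 p.2) ⁻¹' Set.Iic t
      = {p : CPath × ℝ | p.2 ≤ runMax p.1.1 t} ∪ {p : CPath × ℝ | ∃ t, p.2 ≤ p.1.1 t}ᶜ := by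
    ext p
    simp only [Set.mem_preimage, Set.mem_Iic, Set.mem_union, Set.mem_compl_iff, Set.mem_ofPred_eq]
    by_cases h : ∃ t, p.2 ≤ p.1.1 t
    · simp only [h, not_true, or_false]
      rw [fpt_le_iff p.1.2 h, le_runMax_iff p.1.2]
    · have he : {t : ℝ≥0 | p.2 ≤ p.1.1 t} = ∅ := by
        ext s
        simp only [Set.mem_ofPred_eq, Set.mem_empty_iff_false, iff_false]
        exact fun hs => h ⟨s, hs⟩
      simp only [h, not_false_iff, or_true, iff_true]
      simp [fpt, he]
  rw [this]
  exact (measurableSet_le_runMax t).union measurableSet_reach.compl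

lemma measurable_scl_joint (H : ℝ) :
    Measurable (fun p : CPath × ℝ≥0 => scl H p.2 p.1.1) := by
  refine measurable_pi_lambda _ fun t => ?_
  have h1 : Measurable (fun q : ℝ≥0 × CPath => q.2.1 q.1) :=
    measurable_uncurry_of_continuous_of_measurable (u := fun (r : ℝ≥0) (f : CPath) => f.1 r)
      (fun f => f.2) (fun r => (measurable_pi_apply r).comp measurable_subtype_coe)
  have h2 : Measurable (fun p : CPath × ℝ≥0 => p.1.1 (p.2 * t)) :=
    h1.comp ((measurable_snd.mul_const t).prodMk measurable_fst)
  exact ((measurable_snd.coe_nnreal_real).pow_const _).mul h2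

/-- The integrand of the time-changed functional, without the set. -/
def kfun (H : ℝ) (g : (ℝ≥0 → ℝ) → ℝ≥0∞) (f : ℝ≥0 → ℝ) (x : ℝ) : ℝ≥0∞ :=
  (reached f).indicator (fun x => g (scl H (fpt f x) f)) x

lemma measurable_kfun (H : ℝ) {g : (ℝ≥0 → ℝ) → ℝ≥0∞} (hg : Measurable g) :
    Measurable (fun p : CPath × ℝ => kfun H g p.1.1 p.2) := by
  have hs : MeasurableSet {p : CPath × ℝ | 0 < p.2 ∧ ∃ t, p.2 ≤ p.1.1 t} :=
    (measurableSet_lt measurable_const measurable_snd).inter measurableSet_reach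
  have h := (hg.comp ((measurable_scl_joint H).comp
    (measurable_fst.prodMk measurable_fpt))).indicator hs
  convert h using 1
  ext p
  simp only [kfun, Set.indicator, reached, Set.mem_ofPred_eq, Function.comp]
  congr

/-- `∫_A g(s_r f) μ_f(dr)`, written by the change of time. -/
def Phi (H : ℝ) (g : (ℝ≥0 → ℝ) → ℝ≥0∞) (A : Set ℝ≥0) (f : ℝ≥0 → ℝ) : ℝ≥0∞ :=
  ∫⁻ x, (fpt f ⁻¹' A).indicator (kfun H g f) x

lemma measurable_integrand (H : ℝ) {g : (ℝ≥0 → ℝ) → ℝ≥0∞} (hg : Measurable g)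
    {A : Set ℝ≥0} (hA : MeasurableSet A) :
    Measurable (fun p : CPath × ℝ => (fpt p.1.1 ⁻¹' A).indicator (kfun H g p.1.1) p.2) := by
  have h := (measurable_kfun H hg).indicator (measurable_fpt hA)
  convert h using 1
  ext p
  by_cases hp : fpt p.1.1 p.2 ∈ A <;> simp [Set.indicator, hp]

lemma measurable_Phi (H : ℝ) {g : (ℝ≥0 → ℝ) → ℝ≥0∞} (hg : Measurable g)
    {A : Set ℝ≥0} (hA : MeasurableSet A) : Measurable (fun f : CPath => Phi H g A f.1) :=
  (measurable_integrand H hg hA).lintegral_prod_right'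

lemma continuous_scl (H : ℝ) (c : ℝ≥0) {f : ℝ≥0 → ℝ} (hf : Continuous f) :
    Continuous (scl H c f) :=
  continuous_const.mul (hf.comp (continuous_const.mul continuous_id))

lemma scl_scl (H : ℝ) (r c : ℝ≥0) (f : ℝ≥0 → ℝ) : scl H r (scl H c f) = scl H (c * r) f := by
  ext t
  simp only [scl]
  rw [NNReal.coe_mul, Real.mul_rpow c.coe_nonneg r.coe_nonneg, mul_assoc c r t]
  ring

lemma le_scl_iff (H : ℝ) {c : ℝ≥0} (hc : 0 < c) (f : ℝ≥0 → ℝ) (x : ℝ) (t : ℝ≥0) :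
    x ≤ scl H c f t ↔ (c : ℝ) ^ H * x ≤ f (c * t) := by
  have hc' : (0 : ℝ) < (c : ℝ) ^ H := Real.rpow_pos_of_pos (by exact_mod_cast hc) _
  rw [scl, Real.rpow_neg c.coe_nonneg, ← div_eq_inv_mul, le_div_iff₀' hc']

lemma reach_scl (H : ℝ) {c : ℝ≥0} (hc : 0 < c) (f : ℝ≥0 → ℝ) (x : ℝ) :
    (∃ t, x ≤ scl H c f t) ↔ ∃ t, (c : ℝ) ^ H * x ≤ f t := by
  constructor
  · rintro ⟨t, ht⟩
    exact ⟨_, (le_scl_iff H hc f x t).1 ht⟩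
  · rintro ⟨t, ht⟩
    refine ⟨c⁻¹ * t, (le_scl_iff H hc f x _).2 ?_⟩
    rwa [mul_inv_cancel_left₀ hc.ne']

lemma fpt_scl (H : ℝ) {c : ℝ≥0} (hc : 0 < c) {f : ℝ≥0 → ℝ} (hf : Continuous f) {x : ℝ}
    (hx : ∃ t, (c : ℝ) ^ H * x ≤ f t) :
    c * fpt (scl H c f) x = fpt f ((c : ℝ) ^ H * x) := by
  refine eq_of_forall_ge_iff fun t => ?_
  rw [fpt_le_iff hf hx, ← le_inv_mul_iff₀ hc, fpt_le_iff (continuous_scl H c hf)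
    ((reach_scl H hc f x).2 hx)]
  constructor
  · rintro ⟨s, hs, h⟩
    exact ⟨c * s, (le_inv_mul_iff₀ hc).1 hs, (le_scl_iff H hc f x s).1 h⟩
  · rintro ⟨s, hs, h⟩
    refine ⟨c⁻¹ * s, by gcongr, (le_scl_iff H hc f x _).2 ?_⟩
    rwa [mul_inv_cancel_left₀ hc.ne']

lemma Phi_scl (H : ℝ) {c : ℝ≥0} (hc : 0 < c) (g : (ℝ≥0 → ℝ) → ℝ≥0∞) (A : Set ℝ≥0)
    {f : ℝ≥0 → ℝ} (hf : Continuous f) :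
    Phi H g ((fun r => c * r) ⁻¹' A) (scl H c f) * ENNReal.ofReal ((c : ℝ) ^ H) = Phi H g A f := by
  have hc' : (0 : ℝ) < (c : ℝ) ^ H := Real.rpow_pos_of_pos (by exact_mod_cast hc) _
  have key : ∀ x, (fpt (scl H c f) ⁻¹' ((fun r => c * r) ⁻¹' A)).indicator
      (kfun H g (scl H c f)) x = (fpt f ⁻¹' A).indicator (kfun H g f) ((c : ℝ) ^ H * x) := by
    intro x
    by_cases hx : x ∈ reached (scl H c f)
    · have hx2 := (reach_scl H hc f x).1 hx.2
      have hx' : (c : ℝ) ^ H * x ∈ reached f := ⟨mul_pos hc' hx.1, hx2⟩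
      have hT := fpt_scl H hc hf hx2
      by_cases hp : c * fpt (scl H c f) x ∈ A <;>
        simp [Set.indicator, kfun, hx, hx', scl_scl, ← hT, hp]
    · have hx' : (c : ℝ) ^ H * x ∉ reached f := by
        rintro ⟨h1, h2⟩
        exact hx ⟨pos_of_mul_pos_right h1 hc'.le |> fun h => h, (reach_scl H hc f x).2 h2⟩
      simp only [Set.indicator, kfun, hx, hx', if_false, ite_self]
  unfold Phi
  simp_rw [key]
  conv_rhs => rw [← Real.smul_map_volume_mul_left hc'.ne']
  rw [lintegral_smul_measure, abs_of_pos hc', smul_eq_mul, mul_comm]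
  congr 1
  exact (lintegral_map_equiv _ (Homeomorph.mulLeft₀ _ hc'.ne').toMeasurableEquiv).symm

lemma hyp_Iic {H : ℝ} (hH : 0 < H) (t : ℝ≥0) :
    hypMeasure H (Set.Iic t) = ENNReal.ofReal ((t : ℝ) ^ H) := by
  have hpre : Real.toNNReal ⁻¹' Set.Iic t = Set.Iic (t : ℝ) := by
    ext x; simp [Real.toNNReal_le_iff_le_coe]
  unfold hypMeasure
  rw [Measure.map_apply measurable_real_toNNReal measurableSet_Iic, hpre,
    withDensity_apply _ measurableSet_Iic, Measure.restrict_restrict measurableSet_Iic]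
  have : Set.Iic (t : ℝ) ∩ Set.Ioi 0 = Set.Ioc 0 (t : ℝ) := by
    ext x; simp [and_comm]
  rw [this]
  have hi : IntervalIntegrable (fun s : ℝ => H * s ^ (H - 1)) volume 0 t :=
    (intervalIntegral.intervalIntegrable_rpow' (by linarith)).const_mul H
  rw [← ofReal_integral_eq_lintegral_ofReal]
  · rw [← intervalIntegral.integral_of_le t.coe_nonneg, intervalIntegral.integral_const_mul,
      integral_rpow (Or.inl (by linarith))]
    congr 1
    rw [sub_add_cancel, Real.zero_rpow hH.ne']
    field_simp
    simp
  · exact (intervalIntegrable_iff_integrableOn_Ioc_of_le t.coe_nonneg).1 hi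
  · filter_upwards [ae_restrict_mem measurableSet_Ioc] with s hs
    have := Real.rpow_nonneg hs.1.le (H - 1)
    positivity

lemma reached_meas (f : CPath) : MeasurableSet (reached f.1) :=
  measurableSet_Ioi.inter (measurable_prodMk_left (x := f) measurableSet_reach)

lemma fpt_meas (f : CPath) : Measurable (fpt f.1) :=
  measurable_fpt.comp (measurable_prodMk_left (x := f))

/-- The record measure as the image of Lebesgue measure under first passage. -/
lemma record_eq (f : CPath) (m : Measure ℝ≥0) (h0 : m {0} = 0)
    (hm : ∀ t : ℝ≥0, 0 < t → m (Set.Ioc 0 t) = ENNReal.ofReal (runMax f.1 t)) :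
    m = Measure.map (fpt f.1) (volume.restrict (reached f.1)) := by
  have hf0 : f.1 0 ≤ 0 := by
    have hlim : Tendsto (fun n : ℕ => m (Set.Ioc 0 (1 / ((n : ℝ≥0) + 1)))) atTop
        (nhds (m (⋂ n : ℕ, Set.Ioc 0 (1 / ((n : ℝ≥0) + 1))))) := by
      refine tendsto_measure_iInter_atTop (fun n => measurableSet_Ioc.nullMeasurableSet) ?_
        ⟨0, ?_⟩
      · intro a b hab
        refine Set.Ioc_subset_Ioc_right ?_
        have : (a : ℝ≥0) ≤ b := by exact_mod_cast hab
        gcongr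
      · rw [hm _ (by positivity)]
        exact ENNReal.ofReal_ne_top
    have hemp : (⋂ n : ℕ, Set.Ioc 0 (1 / ((n : ℝ≥0) + 1))) = ∅ := by
      ext x
      simp only [Set.mem_iInter, Set.mem_Ioc, Set.mem_empty_iff_false, iff_false, not_forall]
      by_cases hx : 0 < x
      · obtain ⟨n, hn⟩ := exists_nat_one_div_lt (K := ℝ) (ε := (x : ℝ)) (by exact_mod_cast hx)
        refine ⟨n, fun h => ?_⟩
        have h2 : (x : ℝ) ≤ 1 / ((n : ℝ) + 1) := by exact_mod_cast h.2
        linarith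
      · exact ⟨0, fun h => hx h.1⟩
    rw [hemp, measure_empty] at hlim
    have hle : ENNReal.ofReal (f.1 0) ≤ 0 := by
      refine ge_of_tendsto' hlim fun n => ?_
      rw [hm _ (by positivity)]
      exact ENNReal.ofReal_le_ofReal ((le_runMax_iff f.2 _ _).2 ⟨0, zero_le, le_rfl⟩)
    simpa using hle
  have hIic : ∀ t : ℝ≥0, m (Set.Iic t) = ENNReal.ofReal (runMax f.1 t) := by
    intro t
    rcases eq_or_lt_of_le (zero_le (a := t)) with rfl | ht
    · have : Set.Iic (0 : ℝ≥0) = {0} := by ext; simp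
      rw [this, h0]
      symm
      rw [ENNReal.ofReal_eq_zero]
      obtain ⟨s, hs, hx⟩ := (le_runMax_iff f.2 (runMax f.1 0) 0).1 le_rfl
      have : s = 0 := le_antisymm hs zero_le
      subst this
      exact hx.trans hf0
    · have : Set.Iic t = {0} ∪ Set.Ioc 0 t := by
        ext x
        simp only [Set.mem_Iic, Set.mem_union, Set.mem_singleton_iff, Set.mem_Ioc]
        rcases eq_or_lt_of_le (zero_le (a := x)) with rfl | hx
        · simp
        · simp [hx, hx.ne']
      refine le_antisymm ?_ ?_
      · rw [this, ← hm t ht]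
        exact (measure_union_le _ _).trans (by rw [h0, zero_add])
      · rw [← hm t ht, this]
        exact measure_mono Set.subset_union_right
  refine Measure.ext_of_generateFrom_of_iUnion (Set.range Set.Iic) (fun n : ℕ => Set.Iic (n : ℝ≥0))
    ?_ isPiSystem_Iic ?_ (fun n => ⟨_, rfl⟩) ?_ ?_
  · rw [← borel_eq_generateFrom_Iic]
    exact BorelSpace.measurable_eq
  · ext x
    simpa using exists_nat_ge x
  · intro n
    rw [hIic]; exact ENNReal.ofReal_ne_top
  · rintro _ ⟨t, rfl⟩
    rw [hIic, Measure.map_apply (fpt_meas f) measurableSet_Iic,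
      Measure.restrict_apply (fpt_meas f measurableSet_Iic)]
    have : fpt f.1 ⁻¹' Set.Iic t ∩ reached f.1 = Set.Ioc 0 (runMax f.1 t) := by
      ext x
      simp only [Set.mem_inter_iff, Set.mem_preimage, Set.mem_Iic, Set.mem_Ioc]
      constructor
      · rintro ⟨h1, h2, h3⟩
        exact ⟨h2, (le_runMax_iff f.2 _ _).2 ((fpt_le_iff f.2 h3 t).1 h1)⟩
      · rintro ⟨h1, h2⟩
        have h3 := (le_runMax_iff f.2 _ _).1 h2
        have h4 : ∃ t, x ≤ f.1 t := h3.imp fun _ h => h.2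
        exact ⟨(fpt_le_iff f.2 h4 t).2 h3, h1, h4⟩
    rw [this, Real.volume_Ioc, sub_zero]

lemma inner_eq_Phi (H : ℝ) {g : (ℝ≥0 → ℝ) → ℝ≥0∞} (hg : Measurable g) (f : CPath)
    (m : Measure ℝ≥0) (h0 : m {0} = 0)
    (hm : ∀ t : ℝ≥0, 0 < t → m (Set.Ioc 0 t) = ENNReal.ofReal (runMax f.1 t))
    {A : Set ℝ≥0} (hA : MeasurableSet A) :
    ∫⁻ r in A, g (scl H r f.1) ∂m = Phi H g A f.1 := by
  have hgm : Measurable (fun r => g (scl H r f.1)) :=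
    hg.comp ((measurable_scl_joint H).comp (measurable_prodMk_left (x := f)))
  rw [record_eq f m h0 hm, ← lintegral_indicator hA,
    lintegral_map (hgm.indicator hA) (fpt_meas f), ← lintegral_indicator (reached_meas f)]
  unfold Phi
  congr 1
  ext x
  by_cases h1 : x ∈ reached f.1 <;> by_cases h2 : fpt f.1 x ∈ A <;>
    simp [Set.indicator, kfun, h1, h2]

/-- for every bounded measurable `g ≥ 0` on path space, the set function
`A ↦ E[∫_A g(s_r X) μ(dr)]` is a multiple of the hyperbolic measure `κ`; in particular the
choice of the reference set in the definition of the Palm measure of `μ` plays no role. -/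
theorem statement14 {Ω : Type*} [MeasurableSpace Ω] (P : Measure Ω) [IsProbabilityMeasure P]
    (H : ℝ) (hH : H ∈ Set.Ioo (0 : ℝ) 1) (X : Ω → ℝ≥0 → ℝ) (hX : Measurable X)
    (hcont : ∀ᵐ ω ∂P, Continuous (X ω))
    (hss : SelfSimilar P H X)
    (hM1 : ∀ᵐ ω ∂P, 0 < runMax (X ω) 1)
    (hint : ∫⁻ ω, ENNReal.ofReal (runMax (X ω) 1) ∂P ≠ ⊤)
    (μ : Ω → Measure ℝ≥0)
    (hμmeas : ∀ A : Set ℝ≥0, MeasurableSet A → Measurable fun ω => μ ω A)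
    (hμ0 : ∀ᵐ ω ∂P, μ ω {0} = 0)
    (hμ : ∀ᵐ ω ∂P, ∀ t : ℝ≥0, 0 < t → μ ω (Set.Ioc 0 t) = ENNReal.ofReal (runMax (X ω) t))
    (g : (ℝ≥0 → ℝ) → ℝ≥0∞) (hg : Measurable g)
    (hgbd : ∃ Cb : ℝ≥0∞, Cb ≠ ⊤ ∧ ∀ f, g f ≤ Cb) :
    ∀ A : Set ℝ≥0, MeasurableSet A →
      ∫⁻ ω, ∫⁻ r in A, g (scl H r (X ω)) ∂(μ ω) ∂P
        = hypMeasure H A * ∫⁻ ω, ∫⁻ r in Set.Ioc 0 1, g (scl H r (X ω)) ∂(μ ω) ∂P := by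
  intro A hA
  obtain ⟨S, hS, hSm, hSc⟩ := hcont.exists_measurable_mem
  classical
  have hSS : ∀ ω, Continuous (if ω ∈ S then X ω else 0) := by
    intro ω
    by_cases h : ω ∈ S
    · simpa [h] using hSc ω h
    · simp only [h, if_false]
      exact (continuous_const : Continuous fun _ : ℝ≥0 => (0 : ℝ))
  let Y : Ω → CPath := fun ω => ⟨if ω ∈ S then X ω else 0, hSS ω⟩
  have hY : Measurable Y := (Measurable.ite hSm hX measurable_const).subtype_mk
  have hYX : ∀ᵐ ω ∂P, (Y ω).1 = X ω := by
    filter_upwards [hS] with ω hω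
    simp [Y, hω]
  -- the left side in terms of `Phi`
  have hF : ∀ B : Set ℝ≥0, MeasurableSet B →
      ∫⁻ ω, ∫⁻ r in B, g (scl H r (X ω)) ∂(μ ω) ∂P = ∫⁻ ω, Phi H g B (Y ω).1 ∂P := by
    intro B hB
    refine lintegral_congr_ae ?_
    filter_upwards [hYX, hμ0, hμ] with ω h1 h2 h3
    rw [← inner_eq_Phi H hg (Y ω) (μ ω) h2 (by rw [h1]; exact h3) hB, h1]
  -- scaling
  have hscale : ∀ c : ℝ≥0, 0 < c → ∀ B : Set ℝ≥0, MeasurableSet B →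
      ∫⁻ ω, Phi H g B (Y ω).1 ∂P
        = (∫⁻ ω, Phi H g ((fun r => c * r) ⁻¹' B) (Y ω).1 ∂P) * ENNReal.ofReal ((c : ℝ) ^ H) := by
    intro c hc B hB
    have hB' : MeasurableSet ((fun r : ℝ≥0 => c * r) ⁻¹' B) := (measurable_const_mul c) hB
    have hsclm : Measurable (scl H c) :=
      measurable_pi_lambda _ fun t => (measurable_pi_apply _).const_mul _
    let Z : Ω → CPath := fun ω => ⟨scl H c (Y ω).1, continuous_scl H c (Y ω).2⟩
    have hZ : Measurable Z := (hsclm.comp (measurable_subtype_coe.comp hY)).subtype_mk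
    have hlaw : Measure.map Z P = Measure.map Y P := by
      ext U hU
      obtain ⟨V, hV, rfl⟩ := hU
      rw [Measure.map_apply hZ (measurable_subtype_coe hV),
        Measure.map_apply hY (measurable_subtype_coe hV)]
      have h := congrArg (fun m => m V) (hss c hc)
      rw [Measure.map_apply (by exact hsclm.comp hX) hV, Measure.map_apply hX hV] at h
      have e1 : P (Z ⁻¹' (Subtype.val ⁻¹' V)) = P ((fun ω => scl H c (X ω)) ⁻¹' V) := by
        refine measure_congr ?_
        filter_upwards [hYX] with ω hω
        refine propext ?_
        change scl H c (Y ω).1 ∈ V ↔ scl H c (X ω) ∈ V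
        rw [hω]
      have e2 : P (Y ⁻¹' (Subtype.val ⁻¹' V)) = P (X ⁻¹' V) := by
        refine measure_congr ?_
        filter_upwards [hYX] with ω hω
        refine propext ?_
        change (Y ω).1 ∈ V ↔ X ω ∈ V
        rw [hω]
      rw [e1, e2]; exact h
    have hP := measurable_Phi H hg hB'
    rw [← lintegral_map hP hY, ← hlaw, lintegral_map hP hZ,
      ← lintegral_mul_const _ (by exact hP.comp hZ)]
    refine lintegral_congr fun ω => ?_
    exact (Phi_scl H hc g B (Y ω).2).symm
  -- the measure
  have hYp : Measurable (fun p : Ω × ℝ => (Y p.1, p.2)) :=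
    (hY.comp measurable_fst).prodMk measurable_snd
  have hT : Measurable (fun p : Ω × ℝ => fpt (Y p.1).1 p.2) := measurable_fpt.comp hYp
  have hk : Measurable (fun p : Ω × ℝ => kfun H g (Y p.1).1 p.2) := (measurable_kfun H hg).comp hYp
  let ν : Measure ℝ≥0 := Measure.map (fun p : Ω × ℝ => fpt (Y p.1).1 p.2)
    ((P.prod volume).withDensity (fun p => kfun H g (Y p.1).1 p.2))
  have hν : ∀ B : Set ℝ≥0, MeasurableSet B → ν B = ∫⁻ ω, Phi H g B (Y ω).1 ∂P := by
    intro B hB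
    simp only [ν]
    rw [Measure.map_apply hT hB, withDensity_apply _ (hT hB), ← lintegral_indicator (hT hB),
      lintegral_prod _ (hk.indicator (hT hB)).aemeasurable]
    rfl
  have hν0 : ν {0} = 0 := by
    rw [hν _ (measurableSet_singleton 0), ← hF _ (measurableSet_singleton 0)]
    rw [lintegral_congr_ae (g := fun _ => 0), lintegral_zero]
    filter_upwards [hμ0] with ω h
    rw [Measure.restrict_eq_zero.2 h, lintegral_zero_measure]
  have hνfin : ν (Set.Ioc 0 1) ≠ ⊤ := by
    obtain ⟨C, hC, hgC⟩ := hgbd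
    rw [hν _ measurableSet_Ioc, ← hF _ measurableSet_Ioc]
    refine ne_top_of_le_ne_top (ENNReal.mul_ne_top hC hint) ?_
    rw [← lintegral_const_mul' _ _ hC]
    refine lintegral_mono_ae ?_
    filter_upwards [hμ] with ω h
    rw [← h 1 one_pos, ← setLIntegral_const]
    exact lintegral_mono fun r => hgC _
  have hν1 : ν (Set.Iic 1) = ν (Set.Ioc 0 1) := by
    have : Set.Iic (1 : ℝ≥0) = {0} ∪ Set.Ioc 0 1 := by
      ext x
      simp only [Set.mem_Iic, Set.mem_union, Set.mem_singleton_iff, Set.mem_Ioc]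
      rcases eq_or_lt_of_le (zero_le (a := x)) with rfl | hx
      · simp
      · simp [hx, hx.ne']
    refine le_antisymm ?_ (measure_mono (this ▸ Set.subset_union_right))
    rw [this]
    exact (measure_union_le _ _).trans (by rw [hν0, zero_add])
  have hνt : ∀ t : ℝ≥0, ν (Set.Iic t) = ν (Set.Ioc 0 1) * ENNReal.ofReal ((t : ℝ) ^ H) := by
    intro t
    rcases eq_or_lt_of_le (zero_le (a := t)) with rfl | ht
    · have : Set.Iic (0 : ℝ≥0) = {0} := by ext; simp
      rw [this, hν0, NNReal.coe_zero, Real.zero_rpow hH.1.ne']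
      simp
    · rw [← hν1, hν _ measurableSet_Iic, hscale t ht _ measurableSet_Iic, hν _ measurableSet_Iic]
      congr 3
      ext ω
      congr 1
      ext r
      simp only [Set.mem_preimage, Set.mem_Iic]
      exact mul_le_iff_le_one_right ht
  have hmain : ν = ν (Set.Ioc 0 1) • hypMeasure H := by
    refine Measure.ext_of_generateFrom_of_iUnion (Set.range Set.Iic)
      (fun n : ℕ => Set.Iic (n : ℝ≥0)) ?_ isPiSystem_Iic ?_ (fun n => ⟨_, rfl⟩) ?_ ?_
    · rw [← borel_eq_generateFrom_Iic]
      exact BorelSpace.measurable_eq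
    · ext x
      simpa using exists_nat_ge x
    · intro n
      rw [hνt]; exact ENNReal.mul_ne_top hνfin ENNReal.ofReal_ne_top
    · rintro _ ⟨t, rfl⟩
      rw [hνt, Measure.smul_apply, hyp_Iic hH.1, smul_eq_mul]
  rw [hF A hA, ← hν A hA, hF _ measurableSet_Ioc, ← hν _ measurableSet_Ioc, mul_comm]
  conv_lhs => rw [hmain]
  rfl
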